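/- Suppose X is path connected and for every homotopy cut-set A for loops α, β based at a common point with the property that the set of components of [0,1]\A has order type ω, the loops α and β are path-homotopic. Then any pair of loops in X admitting a scattered homotopy cut-set are path-homotopic, i.e. X has well-defined scattered π₁-products. -/

import Mathlib

open unitInterval

variable {X : Type*} [TopologicalSpace X]

noncomputable def subpath (α : C(ℝ, X)) (a b : ℝ) : Path (α a) (α b) where
  toFun t := α (a + (t : ℝ) * (b - a))
  continuous_toFun := α.continuous.comp (by continuity)
  source' := by simp
  target' := by
    show α (a + ((1 : unitInterval) : ℝ) * (b - a)) = α b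
    rw [Set.Icc.coe_one, one_mul]
    congr 1
    ring

def HomotopyCutSet (α β : C(ℝ, X)) (A : Set ℝ) : Prop :=
  IsClosed A ∧ IsNowhereDense A ∧ A ⊆ Set.Icc 0 1 ∧ (0:ℝ) ∈ A ∧ (1:ℝ) ∈ A ∧
  Set.EqOn α β A ∧
  ∀ a ∈ A, ∀ b ∈ A, a < b → A ∩ Set.Ioo a b = ∅ →
    ∀ (h1 : α a = β a) (h2 : α b = β b),
      (subpath α a b).Homotopic ((subpath β a b).cast h1 h2)

def awSet (X : Type*) [TopologicalSpace X] : Set X :=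
  {x | ∃ γ : ℕ → Path x x, (∀ n, ¬(γ n).Homotopic (Path.refl x)) ∧
    ∀ U ∈ nhds x, ∀ᶠ n in Filter.atTop, Set.range (γ n) ⊆ U}

def ScatteredSet {Y : Type*} [TopologicalSpace Y] (S : Set Y) : Prop :=
  ∀ T ⊆ S, T.Nonempty → ∃ x ∈ T, ∃ U : Set Y, IsOpen U ∧ U ∩ T = {x}

/-- The set of components of `[0,1] \ A`, encoded by their endpoint pairs. -/
def comps (A : Set ℝ) : Set (ℝ × ℝ) :=
  {p | p.1 ∈ A ∧ p.2 ∈ A ∧ p.1 < p.2 ∧ A ∩ Set.Ioo p.1 p.2 = ∅}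

/-- `comps A` has order type `ω`: it admits an order-respecting enumeration by `ℕ`. -/
def OrderTypeOmega (A : Set ℝ) : Prop :=
  ∃ e : ℕ → ℝ × ℝ, Function.Injective e ∧ (∀ n, e n ∈ comps A) ∧
    (∀ p ∈ comps A, ∃ n, e n = p) ∧ ∀ n, (e n).2 ≤ (e (n + 1)).1

open unitInterval Filter Topology

/-- `α` and `β` agree at `c`, `d` and are path-homotopic between them. -/
def PH {X : Type*} [TopologicalSpace X] (α β : C(ℝ, X)) (c d : ℝ) : Prop :=
  ∃ (h1 : α c = β c) (h2 : α d = β d),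
    (subpath α c d).Homotopic ((subpath β c d).cast h1 h2)

/-- The linear path in `ℝ`. -/
noncomputable def linPath (a b : ℝ) : Path a b where
  toFun t := a + (t : ℝ) * (b - a)
  continuous_toFun := by fun_prop
  source' := by simp
  target' := by simp

theorem subpath_eq_map {X : Type*} [TopologicalSpace X] (α : C(ℝ, X)) (a b : ℝ) :
    subpath α a b = (linPath a b).map α.continuous := rfl

theorem subpath_trans {X : Type*} [TopologicalSpace X] (α : C(ℝ, X)) (a b c : ℝ) :
    ((subpath α a b).trans (subpath α b c)).Homotopic (subpath α a c) := by
  rw [subpath_eq_map, subpath_eq_map, subpath_eq_map, ← Path.map_trans]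
  exact (SimplyConnectedSpace.paths_homotopic ((linPath a b).trans (linPath b c))
    (linPath a c)).map α

theorem subpath_symm {X : Type*} [TopologicalSpace X] (α : C(ℝ, X)) (a b : ℝ) :
    (subpath α a b).symm = subpath α b a := by
  ext t
  show α _ = α _
  congr 1
  simp
  ring

theorem PH.refl {X : Type*} [TopologicalSpace X] {α β : C(ℝ, X)} {c : ℝ} (h : α c = β c) :
    PH α β c c := by
  refine ⟨h, h, ?_⟩
  have : subpath α c c = (subpath β c c).cast h h := by
    ext t
    show α _ = β _
    simpa using h
  rw [this]

theorem cast_homotopic {X : Type*} [TopologicalSpace X] {a b a' b' : X} {p q : Path a b}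
    (h : p.Homotopic q) (h1 : a' = a) (h2 : b' = b) :
    (p.cast h1 h2).Homotopic (q.cast h1 h2) := by
  subst h1; subst h2; exact h

theorem PH.symm {X : Type*} [TopologicalSpace X] {α β : C(ℝ, X)} {c d : ℝ} (h : PH α β c d) :
    PH α β d c := by
  obtain ⟨h1, h2, h⟩ := h
  refine ⟨h2, h1, ?_⟩
  rw [← subpath_symm α, ← subpath_symm β]
  exact h.symm₂

theorem PH.trans {X : Type*} [TopologicalSpace X] {α β : C(ℝ, X)} {c d e : ℝ}
    (h : PH α β c d) (h' : PH α β d e) : PH α β c e := by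
  obtain ⟨h1, h2, h⟩ := h
  obtain ⟨h3, h4, h'⟩ := h'
  refine ⟨h1, h4, ?_⟩
  have k := cast_homotopic (subpath_trans β c d e) h1 h4
  refine ((subpath_trans α c d e).symm.trans (h.hcomp h')).trans (Path.Homotopic.trans ?_ k)
  have : ((subpath β c d).cast h1 h2).trans ((subpath β d e).cast h3 h4) =
      ((subpath β c d).trans (subpath β d e)).cast h1 h4 := by
    ext t
    simp [Path.trans_apply]
  rw [this]

/-- Transport of homotopies along a reparametrisation. -/
theorem PH.comp {X : Type*} [TopologicalSpace X] {α β : C(ℝ, X)} (φ : C(ℝ, ℝ)) {s t : ℝ} :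
    PH (α.comp φ) (β.comp φ) s t ↔ PH α β (φ s) (φ t) := by
  have key : ∀ α : C(ℝ, X), (subpath (α.comp φ) s t).Homotopic (subpath α (φ s) (φ t)) := by
    intro α
    exact (SimplyConnectedSpace.paths_homotopic ((linPath s t).map φ.continuous)
      (linPath (φ s) (φ t))).map α
  constructor
  · rintro ⟨h1, h2, h⟩
    exact ⟨h1, h2, ((key α).symm.trans h).trans (cast_homotopic (key β) h1 h2)⟩
  · rintro ⟨h1, h2, h⟩
    exact ⟨h1, h2, ((key α).trans h).trans (cast_homotopic (key β) h1 h2).symm⟩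

theorem PH.congr_right {X : Type*} [TopologicalSpace X] {α β β' : C(ℝ, X)} {s t : ℝ} (hst : s ≤ t)
    (h : PH α β s t) (hb : ∀ y ∈ Set.Icc s t, β y = β' y) : PH α β' s t := by
  obtain ⟨h1, h2, h⟩ := h
  have e1 := hb s ⟨le_rfl, hst⟩
  have e2 := hb t ⟨hst, le_rfl⟩
  refine ⟨h1.trans e1, h2.trans e2, ?_⟩
  have : (subpath β s t).cast h1 h2 = (subpath β' s t).cast (h1.trans e1) (h2.trans e2) := by
    ext y
    show β _ = β' _
    apply hb
    have := y.2.1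
    have := y.2.2
    constructor <;> nlinarith
  rw [← this]
  exact h

def OmegaHyp (X : Type*) [TopologicalSpace X] : Prop :=
  ∀ (α β : C(ℝ, X)) (A : Set ℝ), HomotopyCutSet α β A →
      α 0 = α 1 → β 0 = β 1 → OrderTypeOmega A →
      ∀ (h1 : α 0 = β 0) (h2 : α 1 = β 1),
        (subpath α 0 1).Homotopic ((subpath β 0 1).cast h1 h2)

theorem omega_lemma {X : Type*} [TopologicalSpace X] (hω : OmegaHyp X) (α β : C(ℝ, X))
    (v : ℕ → ℝ) (v0 : v 0 = 0) (hv : StrictMono v) (hlim : Tendsto v atTop (𝓝 1))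
    (hP : ∀ n, PH α β (v n) (v (n + 1))) (h1 : α 1 = β 1) (h01 : α 0 = α 1) :
    PH α β 0 1 := by
  have hlt : ∀ n, v n < 1 := fun n =>
    lt_of_lt_of_le (hv (Nat.lt_succ_self n)) (hv.monotone.ge_of_tendsto hlim _)
  have h0 : α 0 = β 0 := by
    obtain ⟨h, _⟩ := hP 0
    rwa [v0] at h
  set A : Set ℝ := insert 1 (Set.range v) with hA
  have hcl : IsClosed A := hlim.isCompact_insert_range.isClosed
  have hcount : A.Countable := (Set.countable_range v).insert 1
  have hgap : ∀ a ∈ A, ∀ b ∈ A, a < b → A ∩ Set.Ioo a b = ∅ →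
      ∃ n, a = v n ∧ b = v (n + 1) := by
    intro a ha b hb hab hemp
    have hb1 : b ≤ 1 := by
      rcases hb with rfl | ⟨m, rfl⟩
      · exact le_rfl
      · exact (hlt m).le
    rcases ha with rfl | ⟨n, rfl⟩
    · exact absurd hab (not_lt.2 hb1)
    refine ⟨n, rfl, ?_⟩
    have hmem : v (n + 1) ∈ A := Or.inr ⟨_, rfl⟩
    have hnot : ¬ v (n + 1) < b := fun h =>
      (Set.eq_empty_iff_forall_notMem.1 hemp) _ ⟨hmem, hv (Nat.lt_succ_self n), h⟩
    rcases hb with rfl | ⟨m, rfl⟩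
    · exact absurd (hlt _) hnot
    · have : n < m := hv.lt_iff_lt.1 hab
      exact le_antisymm (not_lt.1 hnot |>.trans le_rfl) (hv.monotone this)
  refine ⟨h0, h1, hω α β A ⟨hcl, ?_, ?_, Or.inr ⟨0, v0⟩, Or.inl rfl, ?_, ?_⟩ h01
    (by rw [← h0, ← h1, h01]) ?_ h0 h1⟩
  · rw [hcl.isNowhereDense_iff]
    exact interior_eq_empty_iff_dense_compl.2 (hcount.dense_compl ℝ)
  · rintro y (rfl | ⟨n, rfl⟩)
    · simp
    · exact ⟨v0 ▸ hv.monotone (Nat.zero_le n), (hlt n).le⟩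
  · rintro y (rfl | ⟨n, rfl⟩)
    · exact h1
    · exact (hP n).1
  · intro a ha b hb hab hemp k1 k2
    obtain ⟨n, rfl, rfl⟩ := hgap a ha b hb hab hemp
    exact (hP n).2.2
  · refine ⟨fun n => (v n, v (n + 1)), ?_, ?_, ?_, ?_⟩
    · intro m n h
      exact hv.injective (Prod.ext_iff.1 h).1
    · intro n
      refine ⟨Or.inr ⟨n, rfl⟩, Or.inr ⟨n + 1, rfl⟩, hv (Nat.lt_succ_self n), ?_⟩
      rw [Set.eq_empty_iff_forall_notMem]
      rintro y ⟨rfl | ⟨m, rfl⟩, hy1, hy2⟩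
      · exact absurd hy2 (not_lt.2 (hlt _).le)
      · have := hv.lt_iff_lt.1 hy1
        have := hv.lt_iff_lt.1 hy2
        omega
    · rintro ⟨a, b⟩ ⟨ha, hb, hab, hemp⟩
      obtain ⟨n, hn, hm⟩ := hgap a ha b hb hab hemp
      exact ⟨n, by rw [hn, hm]⟩
    · intro n; exact le_rfl

theorem seq_lemma {X : Type*} [TopologicalSpace X] (hω : OmegaHyp X) (α β : C(ℝ, X))
    (u : ℕ → ℝ) (x : ℝ) (hne : x - u 0 ≠ 0)
    (hmono : StrictMono fun n => (u n - u 0) / (x - u 0)) (hlim : Tendsto u atTop (𝓝 x))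
    (hP : ∀ n, PH α β (u n) (u (n + 1))) (hx : α x = β x) : PH α β (u 0) x := by
  let φ : C(ℝ, ℝ) := ⟨fun t => u 0 + |2 * t - 1| * (x - u 0), by fun_prop⟩
  have hφ : ∀ t, φ t = u 0 + |2 * t - 1| * (x - u 0) := fun t => rfl
  have φ0 : φ 0 = x := by rw [hφ]; norm_num
  have φ1 : φ 1 = x := by rw [hφ]; norm_num
  have φh : φ (1/2) = u 0 := by rw [hφ]; norm_num
  let β' : C(ℝ, X) := ⟨fun t => if t ≤ 1/2 then α (φ t) else β (φ t), by
    refine Continuous.if_le (by fun_prop) (by fun_prop) continuous_id continuous_const ?_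
    intro t ht
    rw [show t = 1/2 from ht, φh]
    exact (hP 0).1⟩
  have hβ1 : ∀ t, t ≤ 1/2 → β' t = α (φ t) := fun t ht => if_pos ht
  have hβ2 : ∀ t, 1/2 ≤ t → β' t = β (φ t) := by
    intro t ht
    rcases ht.eq_or_lt with rfl | h
    · rw [hβ1 _ le_rfl, φh]; exact (hP 0).1
    · exact if_neg (not_le.2 h)
  let r : ℕ → ℝ := fun n => (u n - u 0) / (x - u 0)
  have r0 : r 0 = 0 := by simp [r]
  have hr0 : ∀ n, 0 ≤ r n := fun n => r0 ▸ hmono.monotone (Nat.zero_le n)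
  have hrlim : Tendsto r atTop (𝓝 1) := by
    have := (hlim.sub_const (u 0)).div_const (x - u 0)
    rwa [div_self hne] at this
  let s : ℕ → ℝ := fun n => (1 + r n) / 2
  have φs : ∀ n, φ (s n) = u n := by
    intro n
    rw [hφ, show 2 * s n - 1 = r n by simp only [s]; ring, abs_of_nonneg (hr0 n)]
    simp only [r]
    field_simp
    ring
  have hs : StrictMono s := by
    intro m n h
    have := hmono h
    simp only [s, r]
    simp only at this
    linarith
  have hsh : ∀ n, 1/2 ≤ s n := by
    intro n
    have := hr0 n
    simp only [s]
    linarith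
  have s0 : s 0 = 1/2 := by simp only [s, r0]; norm_num
  have hslim : Tendsto s atTop (𝓝 1) := by
    have := (hrlim.const_add 1).div_const 2
    norm_num at this
    exact this
  let v : ℕ → ℝ := fun n => Nat.casesOn n 0 s
  have hstep : ∀ c d, 1/2 ≤ c → c ≤ d → (PH α β (φ c) (φ d) ↔ PH (α.comp φ) β' c d) := by
    intro c d hc hcd
    rw [← PH.comp φ]
    constructor
    · intro h
      exact h.congr_right hcd fun y hy => (hβ2 y (hc.trans hy.1)).symm
    · intro h
      exact h.congr_right hcd fun y hy => (hβ2 y (hc.trans hy.1))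
  have hfirst : PH (α.comp φ) β' 0 (1/2) := by
    have h : PH (α.comp φ) (α.comp φ) 0 (1/2) := ⟨rfl, rfl, Path.Homotopic.refl _⟩
    exact h.congr_right (by norm_num) fun y hy => (hβ1 y hy.2).symm
  have hall : PH (α.comp φ) β' 0 1 := by
    refine omega_lemma hω (α.comp φ) β' v rfl ?_ ?_ ?_ ?_ ?_
    · apply strictMono_nat_of_lt_succ
      rintro (_ | n)
      · show (0:ℝ) < s 0
        rw [s0]; norm_num
      · exact hs (Nat.lt_succ_self n)
    · exact (tendsto_add_atTop_iff_nat (f := v) 1).1 hslim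
    · rintro (_ | n)
      · show PH _ _ 0 (s 0)
        rw [s0]; exact hfirst
      · show PH _ _ (s n) (s (n + 1))
        rw [← hstep _ _ (hsh n) (hs (Nat.lt_succ_self n)).le, φs, φs]
        exact hP n
    · show α (φ 1) = _
      rw [hβ2 1 (by norm_num), φ1, hx]
    · show α (φ 0) = α (φ 1)
      rw [φ0, φ1]
  have := (hstep (1/2) 1 le_rfl (by norm_num)).2 (hfirst.symm.trans hall)
  rwa [φh, φ1] at this

theorem connect_lemma {X : Type*} [TopologicalSpace X] {α β : C(ℝ, X)} {A : Set ℝ}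
    (hcl : IsClosed A) (heq : Set.EqOn α β A)
    (hgap : ∀ a ∈ A, ∀ b ∈ A, a < b → A ∩ Set.Ioo a b = ∅ → PH α β a b)
    {c d : ℝ} (hc : c ∈ A) (hd : d ∈ A) (hcd : c ≤ d)
    (hloc : ∀ y ∈ A, c ≤ y → y ≤ d → ∀ᶠ z in 𝓝[A] y, PH α β y z) : PH α β c d := by
  let S : Set ℝ := {y | y ∈ A ∧ c ≤ y ∧ y ≤ d ∧ PH α β c y}
  have hcS : c ∈ S := ⟨hc, le_rfl, hcd, PH.refl (heq hc)⟩
  have hbdd : BddAbove S := ⟨d, fun y hy => hy.2.2.1⟩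
  let y := sSup S
  have hyc : c ≤ y := le_csSup hbdd hcS
  have hyd : y ≤ d := csSup_le ⟨c, hcS⟩ fun y hy => hy.2.2.1
  have hcly : y ∈ closure S := csSup_mem_closure ⟨c, hcS⟩ hbdd
  have hyA : y ∈ A := hcl.closure_subset_iff.2 (fun z hz => hz.1) hcly
  have hl := hloc y hyA hyc hyd
  have hPy : PH α β c y := by
    have hfr : ∃ᶠ z in 𝓝 y, z ∈ S := mem_closure_iff_frequently.1 hcly
    obtain ⟨z, hz, hz'⟩ := (hfr.and_eventually (eventually_nhdsWithin_iff.1 hl)).exists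
    exact hz.2.2.2.trans (hz' hz.1).symm
  rcases hyd.eq_or_lt with h | hlt
  · rwa [h] at hPy
  exfalso
  have hnone : ∀ z ∈ A, y < z → z ≤ d → ¬ PH α β y z := by
    intro z hz hyz hzd h
    exact absurd (le_csSup hbdd (⟨hz, hyc.trans hyz.le, hzd, hPy.trans h⟩ : z ∈ S)) (not_le.2 hyz)
  let B : Set ℝ := A ∩ Set.Ioc y d
  have hdB : d ∈ B := ⟨hd, hlt, le_rfl⟩
  have hBb : BddBelow B := ⟨y, fun z hz => hz.2.1.le⟩
  have hw : sInf B ∈ closure B := csInf_mem_closure ⟨d, hdB⟩ hBb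
  have hwA : sInf B ∈ A := hcl.closure_subset_iff.2 (fun z hz => hz.1) hw
  have hyw : y ≤ sInf B := le_csInf ⟨d, hdB⟩ fun z hz => hz.2.1.le
  have hwd : sInf B ≤ d := csInf_le hBb hdB
  rcases hyw.eq_or_lt with h | h
  · rw [← h] at hw
    obtain ⟨z, hz, hz'⟩ := ((mem_closure_iff_frequently.1 hw).and_eventually
      (eventually_nhdsWithin_iff.1 hl)).exists
    exact hnone z hz.1 hz.2.1 hz.2.2 (hz' hz.1)
  · refine hnone _ hwA h hwd (hgap y hyA _ hwA h ?_)
    rw [Set.eq_empty_iff_forall_notMem]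
    rintro z ⟨hz, hz1, hz2⟩
    exact absurd (csInf_le hBb (⟨hz, hz1, hz2.le.trans hwd⟩ : z ∈ B)) (not_le.2 hz2)

theorem main_lemma {X : Type*} [TopologicalSpace X] (hω : OmegaHyp X) {α β : C(ℝ, X)} {A : Set ℝ}
    (hcl : IsClosed A) (heq : Set.EqOn α β A)
    (hgap : ∀ a ∈ A, ∀ b ∈ A, a < b → A ∩ Set.Ioo a b = ∅ → PH α β a b)
    (hsc : ScatteredSet A) : ∀ x ∈ A, ∀ᶠ z in 𝓝[A] x, PH α β x z := by
  by_contra hcon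
  push Not at hcon
  obtain ⟨x₀, hx₀, hx₀'⟩ := hcon
  let T : Set ℝ := {x | x ∈ A ∧ ¬ ∀ᶠ z in 𝓝[A] x, PH α β x z}
  obtain ⟨x, hxT, U, hU, hUT⟩ := hsc T (fun y hy => hy.1) ⟨x₀, hx₀, by simpa using hx₀'⟩
  have hxU : x ∈ U := by
    have : x ∈ U ∩ T := hUT ▸ rfl
    exact this.1
  obtain ⟨δ, hδ, hball⟩ := Metric.isOpen_iff.1 hU x hxU
  have hgood : ∀ y ∈ A, y ≠ x → |y - x| < δ → ∀ᶠ z in 𝓝[A] y, PH α β y z := by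
    intro y hy hne hyx
    by_contra hn
    have : y ∈ U ∩ T := ⟨hball (by rwa [Metric.mem_ball, Real.dist_eq]), hy, hn⟩
    rw [hUT] at this
    exact hne this
  have hR : ∀ c ∈ A, ∀ d ∈ A, x < c → d < x + δ → c ≤ d → PH α β c d := by
    intro c hc d hd h1 h2 h3
    refine connect_lemma hcl heq hgap hc hd h3 fun y hy h4 h5 => hgood y hy ?_ ?_
    · exact (h1.trans_le h4).ne'
    · rw [abs_lt]; constructor <;> linarith
  have hL : ∀ c ∈ A, ∀ d ∈ A, x - δ < c → d < x → c ≤ d → PH α β c d := by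
    intro c hc d hd h1 h2 h3
    refine connect_lemma hcl heq hgap hc hd h3 fun y hy h4 h5 => hgood y hy ?_ ?_
    · exact (h5.trans_lt h2).ne
    · rw [abs_lt]; constructor <;> linarith
  have hxA := hxT.1
  have eR : ∀ᶠ z in 𝓝 x, z ∈ A → x < z → PH α β x z := by
    by_cases hx : x ∈ closure (A ∩ Set.Ioo x (x + δ))
    · have hglb : IsGLB (A ∩ Set.Ioo x (x + δ)) x :=
        isGLB_of_mem_closure (fun z hz => hz.2.1.le) hx
      obtain ⟨u, hu, hxu, hul, hut⟩ := hglb.exists_seq_strictAnti_tendsto_of_notMem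
        (fun h => lt_irrefl _ h.2.1) (closure_nonempty_iff.1 ⟨x, hx⟩)
      have hneg : x - u 0 < 0 := by linarith [hxu 0]
      have h0 : PH α β (u 0) x := by
        refine seq_lemma hω α β u x hneg.ne ?_ hul ?_ (heq hxA)
        · intro m n hmn
          have := hu hmn
          simp only
          rw [div_lt_div_right_of_neg hneg]
          linarith
        · intro n
          exact (hR _ (hut _).1 _ (hut _).1 (hxu _) (hut n).2.2
            (hu (Nat.lt_succ_self n)).le).symm
      filter_upwards [Iio_mem_nhds (show x < x + δ by linarith)] with z hz hzA hxz
      refine h0.symm.trans ?_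
      rcases le_total (u 0) z with h | h
      · exact hR _ (hut 0).1 _ hzA (hxu 0) hz h
      · exact (hR _ hzA _ (hut 0).1 hxz (hut 0).2.2 h).symm
    · have : (closure (A ∩ Set.Ioo x (x + δ)))ᶜ ∈ 𝓝 x := isClosed_closure.isOpen_compl.mem_nhds hx
      filter_upwards [this, Iio_mem_nhds (show x < x + δ by linarith)] with z hz hz2 hzA hxz
      exact absurd (subset_closure (show z ∈ A ∩ Set.Ioo x (x + δ) from ⟨hzA, hxz, hz2⟩)) hz
  have eL : ∀ᶠ z in 𝓝 x, z ∈ A → z < x → PH α β x z := by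
    by_cases hx : x ∈ closure (A ∩ Set.Ioo (x - δ) x)
    · have hlub : IsLUB (A ∩ Set.Ioo (x - δ) x) x :=
        isLUB_of_mem_closure (fun z hz => hz.2.2.le) hx
      obtain ⟨u, hu, hxu, hul, hut⟩ := hlub.exists_seq_strictMono_tendsto_of_notMem
        (fun h => lt_irrefl _ h.2.2) (closure_nonempty_iff.1 ⟨x, hx⟩)
      have hpos : 0 < x - u 0 := by linarith [hxu 0]
      have h0 : PH α β (u 0) x := by
        refine seq_lemma hω α β u x hpos.ne' ?_ hul ?_ (heq hxA)
        · intro m n hmn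
          have := hu hmn
          simp only
          rw [div_lt_div_iff_of_pos_right hpos]
          linarith
        · intro n
          exact hL _ (hut _).1 _ (hut _).1 (hut n).2.1 (hxu _)
            (hu (Nat.lt_succ_self n)).le
      filter_upwards [Ioi_mem_nhds (show x - δ < x by linarith)] with z hz hzA hxz
      refine h0.symm.trans ?_
      rcases le_total (u 0) z with h | h
      · exact hL _ (hut 0).1 _ hzA (hut 0).2.1 hxz h
      · exact (hL _ hzA _ (hut 0).1 hz (hxu 0) h).symm
    · have : (closure (A ∩ Set.Ioo (x - δ) x))ᶜ ∈ 𝓝 x := isClosed_closure.isOpen_compl.mem_nhds hx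
      filter_upwards [this, Ioi_mem_nhds (show x - δ < x by linarith)] with z hz hz2 hzA hxz
      exact absurd (subset_closure (show z ∈ A ∩ Set.Ioo (x - δ) x from ⟨hzA, hz2, hxz⟩)) hz
  apply hxT.2
  rw [eventually_nhdsWithin_iff]
  filter_upwards [eR, eL] with z h1 h2 hz
  rcases lt_trichotomy x z with h | h | h
  · exact h1 hz h
  · rw [← h]; exact PH.refl (heq hxA)
  · exact h2 hz h

/-- If `X` is path connected and any pair of loops based at a common point admitting a homotopy
cut-set whose set of components has order type `ω` are path-homotopic, then any pair of loops
admitting a scattered homotopy cut-set are path-homotopic (well-defined scattered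
`π₁`-products). -/
theorem stmt18 {X : Type*} [TopologicalSpace X] [PathConnectedSpace X]
    (hω : ∀ (α β : C(ℝ, X)) (A : Set ℝ), HomotopyCutSet α β A →
      α 0 = α 1 → β 0 = β 1 → OrderTypeOmega A →
      ∀ (h1 : α 0 = β 0) (h2 : α 1 = β 1),
        (subpath α 0 1).Homotopic ((subpath β 0 1).cast h1 h2)) :
    ∀ (α β : C(ℝ, X)) (A : Set ℝ), HomotopyCutSet α β A →
      α 0 = α 1 → β 0 = β 1 → ScatteredSet A →
      ∀ (h1 : α 0 = β 0) (h2 : α 1 = β 1),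
        (subpath α 0 1).Homotopic ((subpath β 0 1).cast h1 h2) := by
  intro α β A hA h0 h0' hsc h1 h2
  obtain ⟨hcl, -, -, hA0, hA1, heq, hg⟩ := hA
  have hgap : ∀ a ∈ A, ∀ b ∈ A, a < b → A ∩ Set.Ioo a b = ∅ → PH α β a b :=
    fun a ha b hb hab he => ⟨heq ha, heq hb, hg a ha b hb hab he _ _⟩
  have hm := main_lemma hω hcl heq hgap hsc
  exact (connect_lemma hcl heq hgap hA0 hA1 zero_le_one fun y hy _ _ => hm y hy).2.2
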